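/- Fix real numbers φ₀ < φ₁ and a < b, set Q := [φ₀,φ₁] × [a,b], and fix n ∈ ℕ. Then there exists a constant C > 0, depending only on n (and Q), such that for all smooth functions σ, v : ℝ × ℝ → ℝ: ‖∂_k v − σ·∂_φ² v‖_n ≤ ‖v‖_{n+1} + C·(‖σ‖₀·‖v‖_{n+2} + ‖σ‖_{n+2}·‖v‖₀). -/

import Mathlib

open Set

/-- Partial derivative in the first variable `φ` of a function on `ℝ × ℝ`. -/
noncomputable def pdφ (u : ℝ × ℝ → ℝ) : ℝ × ℝ → ℝ :=
  fun p => deriv (fun x => u (x, p.2)) p.1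

/-- Partial derivative in the second variable `k` of a function on `ℝ × ℝ`. -/
noncomputable def pdk (u : ℝ × ℝ → ℝ) : ℝ × ℝ → ℝ :=
  fun p => deriv (fun y => u (p.1, y)) p.2

/-- `sup_{p ∈ Q} |u p|`, the uniform norm over `Q`. -/
noncomputable def supQ (Q : Set (ℝ × ℝ)) (u : ℝ × ℝ → ℝ) : ℝ :=
  ⨆ p : Q, |u ↑p|

/-- The graded seminorm `‖u‖_n = ∑_{j=0}^n ∑_{α₁+α₂=j} sup_Q |∂_φ^{α₁} ∂_k^{α₂} u|`. -/
noncomputable def gnorm (Q : Set (ℝ × ℝ)) (n : ℕ) (u : ℝ × ℝ → ℝ) : ℝ :=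
  ∑ j ∈ Finset.range (n + 1), ∑ i ∈ Finset.range (j + 1),
    supQ Q (pdφ^[i] (pdk^[j - i] u))

/-- Smooth functions of two variables. -/
def Sm (u : ℝ × ℝ → ℝ) : Prop := ContDiff ℝ (⊤ : ℕ∞) u

lemma Sm.diff {u : ℝ × ℝ → ℝ} (h : Sm u) : Differentiable ℝ u :=
  ContDiff.differentiable h (by simp)

lemma Sm.hasφ {u : ℝ × ℝ → ℝ} (h : Sm u) (p : ℝ × ℝ) :
    HasDerivAt (fun x => u (x, p.2)) (fderiv ℝ u p (1, 0)) p.1 := by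
  have h1 : HasFDerivAt u (fderiv ℝ u p) (p.1, p.2) := (h.diff p).hasFDerivAt
  have h2 : HasDerivAt (fun x : ℝ => (x, p.2)) ((1 : ℝ), (0 : ℝ)) p.1 :=
    (hasDerivAt_id p.1).prodMk (hasDerivAt_const p.1 p.2)
  exact h1.comp_hasDerivAt p.1 h2

lemma Sm.hask {u : ℝ × ℝ → ℝ} (h : Sm u) (p : ℝ × ℝ) :
    HasDerivAt (fun y => u (p.1, y)) (fderiv ℝ u p (0, 1)) p.2 := by
  have h1 : HasFDerivAt u (fderiv ℝ u p) (p.1, p.2) := (h.diff p).hasFDerivAt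
  have h2 : HasDerivAt (fun y : ℝ => (p.1, y)) ((0 : ℝ), (1 : ℝ)) p.2 :=
    (hasDerivAt_const p.2 p.1).prodMk (hasDerivAt_id p.2)
  exact h1.comp_hasDerivAt p.2 h2

lemma pdφ_eq {u : ℝ × ℝ → ℝ} (h : Sm u) : pdφ u = fun p => fderiv ℝ u p (1, 0) := by
  funext p
  exact (h.hasφ p).deriv

lemma pdk_eq {u : ℝ × ℝ → ℝ} (h : Sm u) : pdk u = fun p => fderiv ℝ u p (0, 1) := by
  funext p
  exact (h.hask p).deriv

lemma Sm.fd {u : ℝ × ℝ → ℝ} (h : Sm u) : ContDiff ℝ (⊤ : ℕ∞) (fderiv ℝ u) :=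
  ContDiff.fderiv_right h (by simp)

lemma Sm.pdφ {u : ℝ × ℝ → ℝ} (h : Sm u) : Sm (pdφ u) := by
  rw [pdφ_eq h]
  exact h.fd.clm_apply contDiff_const

lemma Sm.pdk {u : ℝ × ℝ → ℝ} (h : Sm u) : Sm (pdk u) := by
  rw [pdk_eq h]
  exact h.fd.clm_apply contDiff_const

lemma Sm.itφ {u : ℝ × ℝ → ℝ} (h : Sm u) (i : ℕ) : Sm (_root_.pdφ^[i] u) := by
  induction i with
  | zero => exact h
  | succ i ih => rw [Function.iterate_succ_apply']; exact ih.pdφ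

lemma Sm.itk {u : ℝ × ℝ → ℝ} (h : Sm u) (i : ℕ) : Sm (_root_.pdk^[i] u) := by
  induction i with
  | zero => exact h
  | succ i ih => rw [Function.iterate_succ_apply']; exact ih.pdk

lemma pd_comm {u : ℝ × ℝ → ℝ} (h : Sm u) : pdk (pdφ u) = pdφ (pdk u) := by
  rw [pdφ_eq h.pdk, pdk_eq h.pdφ, pdk_eq h, pdφ_eq h]
  funext p
  have hd : DifferentiableAt ℝ (fderiv ℝ u) p := (h.fd.differentiable (by simp)) p
  have hs : IsSymmSndFDerivAt ℝ u p :=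
    ContDiffAt.isSymmSndFDerivAt (ContDiff.contDiffAt h) (by
      simp only [minSmoothness_of_isRCLikeNormedField]
      exact WithTop.coe_le_coe.2 (le_top : (2 : ℕ∞) ≤ ⊤))
  rw [fderiv_clm_apply hd (differentiableAt_const _), fderiv_clm_apply hd (differentiableAt_const _)]
  simp
  exact hs _ _

lemma pd_comm_it {u : ℝ × ℝ → ℝ} (h : Sm u) (i : ℕ) :
    pdk (pdφ^[i] u) = pdφ^[i] (pdk u) := by
  induction i with
  | zero => rfl
  | succ i ih =>
    rw [Function.iterate_succ_apply', Function.iterate_succ_apply', pd_comm (h.itφ i), ih]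

lemma pdφ_add {u w : ℝ × ℝ → ℝ} (hu : Sm u) (hw : Sm w) :
    pdφ (u + w) = pdφ u + pdφ w := by
  funext p
  exact ((hu.hasφ p).add (hw.hasφ p)).deriv.trans
    (by rw [Pi.add_apply, pdφ_eq hu, pdφ_eq hw])

lemma pdk_add {u w : ℝ × ℝ → ℝ} (hu : Sm u) (hw : Sm w) :
    pdk (u + w) = pdk u + pdk w := by
  funext p
  exact ((hu.hask p).add (hw.hask p)).deriv.trans
    (by rw [Pi.add_apply, pdk_eq hu, pdk_eq hw])

lemma pdφ_sub {u w : ℝ × ℝ → ℝ} (hu : Sm u) (hw : Sm w) :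
    pdφ (u - w) = pdφ u - pdφ w := by
  funext p
  exact ((hu.hasφ p).sub (hw.hasφ p)).deriv.trans
    (by rw [Pi.sub_apply, pdφ_eq hu, pdφ_eq hw])

lemma pdk_sub {u w : ℝ × ℝ → ℝ} (hu : Sm u) (hw : Sm w) :
    pdk (u - w) = pdk u - pdk w := by
  funext p
  exact ((hu.hask p).sub (hw.hask p)).deriv.trans
    (by rw [Pi.sub_apply, pdk_eq hu, pdk_eq hw])

lemma pdφ_mul {u w : ℝ × ℝ → ℝ} (hu : Sm u) (hw : Sm w) :
    pdφ (u * w) = pdφ u * w + u * pdφ w := by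
  funext p
  refine ((hu.hasφ p).mul (hw.hasφ p)).deriv.trans ?_
  simp [pdφ_eq hu, pdφ_eq hw]

lemma pdk_mul {u w : ℝ × ℝ → ℝ} (hu : Sm u) (hw : Sm w) :
    pdk (u * w) = pdk u * w + u * pdk w := by
  funext p
  refine ((hu.hask p).mul (hw.hask p)).deriv.trans ?_
  simp [pdk_eq hu, pdk_eq hw]

lemma pdφ_it_sub {u w : ℝ × ℝ → ℝ} (hu : Sm u) (hw : Sm w) (i : ℕ) :
    pdφ^[i] (u - w) = pdφ^[i] u - pdφ^[i] w := by
  induction i with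
  | zero => rfl
  | succ i ih =>
    simp only [Function.iterate_succ_apply', ih, pdφ_sub (hu.itφ i) (hw.itφ i)]

lemma pdk_it_sub {u w : ℝ × ℝ → ℝ} (hu : Sm u) (hw : Sm w) (i : ℕ) :
    pdk^[i] (u - w) = pdk^[i] u - pdk^[i] w := by
  induction i with
  | zero => rfl
  | succ i ih =>
    simp only [Function.iterate_succ_apply', ih, pdk_sub (hu.itk i) (hw.itk i)]

/-- Sums of `c` products of derivatives of `f` and `g` of total order `m`. -/
inductive LB (f g : ℝ × ℝ → ℝ) : ℕ → ℕ → (ℝ × ℝ → ℝ) → Prop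
  | prod (i l i' l' : ℕ) :
      LB f g (i + l + (i' + l')) 1 (pdφ^[i] (pdk^[l] f) * pdφ^[i'] (pdk^[l'] g))
  | add {m c c' : ℕ} {h h' : ℝ × ℝ → ℝ} (h1 : LB f g m c h) (h2 : LB f g m c' h') :
      LB f g m (c + c') (h + h')

lemma LB.sm {f g : ℝ × ℝ → ℝ} (hf : Sm f) (hg : Sm g) {m c : ℕ} {h : ℝ × ℝ → ℝ}
    (H : LB f g m c h) : Sm h := by
  induction H with
  | prod i l i' l' => exact ContDiff.mul ((hf.itk l).itφ i) ((hg.itk l').itφ i')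
  | add h1 h2 ih1 ih2 => exact ContDiff.add ih1 ih2

lemma LB.dφ {f g : ℝ × ℝ → ℝ} (hf : Sm f) (hg : Sm g) {m c : ℕ} {h : ℝ × ℝ → ℝ}
    (H : LB f g m c h) : LB f g (m + 1) (2 * c) (pdφ h) := by
  induction H with
  | prod i l i' l' =>
    rw [pdφ_mul ((hf.itk l).itφ i) ((hg.itk l').itφ i')]
    have h1 := LB.prod (f := f) (g := g) (i + 1) l i' l'
    have h2 := LB.prod (f := f) (g := g) i l (i' + 1) l'
    rw [Function.iterate_succ_apply', show i + 1 + l + (i' + l') = i + l + (i' + l') + 1 by ring]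
      at h1
    rw [Function.iterate_succ_apply', show i + l + (i' + 1 + l') = i + l + (i' + l') + 1 by ring]
      at h2
    exact h1.add h2
  | add h1 h2 ih1 ih2 =>
    rw [pdφ_add (h1.sm hf hg) (h2.sm hf hg), mul_add]
    exact ih1.add ih2

lemma LB.dk {f g : ℝ × ℝ → ℝ} (hf : Sm f) (hg : Sm g) {m c : ℕ} {h : ℝ × ℝ → ℝ}
    (H : LB f g m c h) : LB f g (m + 1) (2 * c) (pdk h) := by
  induction H with
  | prod i l i' l' =>
    rw [pdk_mul ((hf.itk l).itφ i) ((hg.itk l').itφ i'), pd_comm_it (hf.itk l),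
      pd_comm_it (hg.itk l')]
    have h1 := LB.prod (f := f) (g := g) i (l + 1) i' l'
    have h2 := LB.prod (f := f) (g := g) i l i' (l' + 1)
    rw [Function.iterate_succ_apply', show i + (l + 1) + (i' + l') = i + l + (i' + l') + 1 by ring]
      at h1
    rw [Function.iterate_succ_apply' pdk l',
      show i + l + (i' + (l' + 1)) = i + l + (i' + l') + 1 by ring] at h2
    exact h1.add h2
  | add h1 h2 ih1 ih2 =>
    rw [pdk_add (h1.sm hf hg) (h2.sm hf hg), mul_add]
    exact ih1.add ih2

lemma LB.itφ {f g : ℝ × ℝ → ℝ} (hf : Sm f) (hg : Sm g) {m c : ℕ} {h : ℝ × ℝ → ℝ}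
    (H : LB f g m c h) (i : ℕ) : LB f g (m + i) (2 ^ i * c) (pdφ^[i] h) := by
  induction i with
  | zero => simpa using H
  | succ i ih =>
    rw [Function.iterate_succ_apply', pow_succ', mul_assoc]
    exact ih.dφ hf hg

lemma LB.itk {f g : ℝ × ℝ → ℝ} (hf : Sm f) (hg : Sm g) {m c : ℕ} {h : ℝ × ℝ → ℝ}
    (H : LB f g m c h) (i : ℕ) : LB f g (m + i) (2 ^ i * c) (pdk^[i] h) := by
  induction i with
  | zero => simpa using H
  | succ i ih =>
    rw [Function.iterate_succ_apply', pow_succ', mul_assoc]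
    exact ih.dk hf hg

lemma LB.bound {f g : ℝ × ℝ → ℝ} {m c : ℕ} {h : ℝ × ℝ → ℝ} (H : LB f g m c h)
    (p : ℝ × ℝ) (B : ℝ)
    (hB : ∀ i l i' l', i + l + (i' + l') = m →
      |pdφ^[i] (pdk^[l] f) p| * |pdφ^[i'] (pdk^[l'] g) p| ≤ B) : |h p| ≤ c * B := by
  induction H with
  | prod i l i' l' =>
    rw [Pi.mul_apply, abs_mul]
    simpa using hB i l i' l' rfl
  | add h1 h2 ih1 ih2 =>
    rw [Pi.add_apply]
    push_cast
    calc _ ≤ _ := abs_add_le _ _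
      _ ≤ _ := add_le_add (ih1 hB) (ih2 hB)
      _ = _ := by ring

/-! ### sup norms -/

lemma supQ_nonneg (Q : Set (ℝ × ℝ)) (u : ℝ × ℝ → ℝ) : 0 ≤ supQ Q u :=
  Real.iSup_nonneg fun _ => abs_nonneg _

lemma le_supQ {Q : Set (ℝ × ℝ)} (hQ : IsCompact Q) {u : ℝ × ℝ → ℝ} (hu : Sm u)
    {p : ℝ × ℝ} (hp : p ∈ Q) : |u p| ≤ supQ Q u := by
  have hb : BddAbove ((fun p => |u p|) '' Q) :=
    hQ.bddAbove_image (ContDiff.continuous hu).abs.continuousOn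
  have : BddAbove (Set.range fun p : Q => |u ↑p|) := by
    rw [Set.image_eq_range] at hb
    exact hb
  exact le_ciSup this ⟨p, hp⟩

lemma supQ_le {Q : Set (ℝ × ℝ)} {u : ℝ × ℝ → ℝ} {B : ℝ} (hB : 0 ≤ B)
    (h : ∀ p ∈ Q, |u p| ≤ B) : supQ Q u ≤ B :=
  Real.iSup_le (fun p => h p p.2) hB

/-- The homogeneous part of order `j`. -/
noncomputable def An (Q : Set (ℝ × ℝ)) (u : ℝ × ℝ → ℝ) (j : ℕ) : ℝ :=
  ∑ i ∈ Finset.range (j + 1), supQ Q (pdφ^[i] (pdk^[j - i] u))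

lemma gnorm_eq (Q : Set (ℝ × ℝ)) (n : ℕ) (u : ℝ × ℝ → ℝ) :
    gnorm Q n u = ∑ j ∈ Finset.range (n + 1), An Q u j := rfl

lemma An_nonneg (Q : Set (ℝ × ℝ)) (u : ℝ × ℝ → ℝ) (j : ℕ) : 0 ≤ An Q u j :=
  Finset.sum_nonneg fun _ _ => supQ_nonneg _ _

lemma le_An (Q : Set (ℝ × ℝ)) (u : ℝ × ℝ → ℝ) (i l : ℕ) :
    supQ Q (pdφ^[i] (pdk^[l] u)) ≤ An Q u (i + l) := by
  have := Finset.single_le_sum (f := fun i' => supQ Q (pdφ^[i'] (pdk^[i + l - i'] u)))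
    (s := Finset.range (i + l + 1)) (fun _ _ => supQ_nonneg _ _)
    (Finset.mem_range.2 (by omega : i < i + l + 1))
  simpa [An] using this

lemma An_le_gnorm (Q : Set (ℝ × ℝ)) (u : ℝ × ℝ → ℝ) {j n : ℕ} (h : j ≤ n) :
    An Q u j ≤ gnorm Q n u :=
  Finset.single_le_sum (f := fun j => An Q u j) (fun _ _ => An_nonneg _ _ _)
    (Finset.mem_range.2 (by omega))

lemma gnorm_zero (Q : Set (ℝ × ℝ)) (u : ℝ × ℝ → ℝ) : gnorm Q 0 u = An Q u 0 := by
  simp [gnorm_eq]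

/-! ### one-dimensional Landau inequality -/

lemma landau1 {g g' g'' : ℝ → ℝ} (hg : ∀ x, HasDerivAt g (g' x) x)
    (hg' : ∀ x, HasDerivAt g' (g'' x) x) {c d M0 M2 h : ℝ} (hh : 0 < h)
    (hL : 2 * h ≤ d - c) (h0 : ∀ x ∈ Icc c d, |g x| ≤ M0) (h2 : ∀ x ∈ Icc c d, |g'' x| ≤ M2)
    {x : ℝ} (hx : x ∈ Icc c d) : h * |g' x| ≤ 2 * M0 + h ^ 2 * M2 := by
  obtain ⟨y, hy, hyx⟩ : ∃ y ∈ Icc c d, |y - x| = h := by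
    rcases le_total (x + h) d with H | H
    · exact ⟨x + h, ⟨by linarith [hx.1], H⟩, by simp [abs_of_pos hh]⟩
    · exact ⟨x - h, ⟨by linarith [hx.1], by linarith [hx.2]⟩, by simp [abs_of_pos hh]⟩
  have key : |g y - g x - g' x * (y - x)| ≤ M2 * h * h := by
    have hlip : ∀ z ∈ uIcc x y, |g' z - g' x| ≤ M2 * h := by
      intro z hz
      have hzI : z ∈ Icc c d := (ordConnected_Icc.uIcc_subset hx hy) hz
      have := (convex_Icc c d).norm_image_sub_le_of_norm_hasDerivWithin_le (f := g') (f' := g'')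
        (fun w _ => (hg' w).hasDerivWithinAt) (fun w hw => h2 w hw) hx hzI
      rw [Real.norm_eq_abs, Real.norm_eq_abs] at this
      have hM : 0 ≤ M2 := (abs_nonneg _).trans (h2 x hx)
      have hzx : |z - x| ≤ h := by
        rw [← hyx]; exact abs_sub_left_of_mem_uIcc hz
      exact this.trans (mul_le_mul_of_nonneg_left hzx hM)
    have := (convex_uIcc x y).norm_image_sub_le_of_norm_hasDerivWithin_le
      (f := fun z => g z - g' x * z) (f' := fun z => g' z - g' x * 1)
      (fun w _ => ((hg w).sub ((hasDerivAt_id w).const_mul (g' x))).hasDerivWithinAt)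
      (C := M2 * h) (fun w hw => by simpa using hlip w hw) left_mem_uIcc right_mem_uIcc
    rw [Real.norm_eq_abs, Real.norm_eq_abs, hyx] at this
    convert this using 2
    ring
  have e : h * |g' x| = |g' x * (y - x)| := by rw [abs_mul, hyx, mul_comm]
  rw [e]
  have a1 := h0 x hx
  have a2 := h0 y hy
  rw [abs_le] at *
  constructor <;> nlinarith

lemma step_φ {φ0 φ1 a b η ε : ℝ} (hη : 0 < η) (hη1 : η ≤ 1) (h1 : 2 * η ≤ φ1 - φ0)
    (hε : 0 < ε) (hε1 : ε ≤ 1) {u : ℝ × ℝ → ℝ} (hu : Sm u) :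
    ε * supQ (Icc φ0 φ1 ×ˢ Icc a b) (pdφ u) ≤
      2 / η * (ε ^ 2 * supQ (Icc φ0 φ1 ×ˢ Icc a b) (pdφ (pdφ u)) +
        supQ (Icc φ0 φ1 ×ˢ Icc a b) u) := by
  set Q := Icc φ0 φ1 ×ˢ Icc a b
  have hQ : IsCompact Q := isCompact_Icc.prod isCompact_Icc
  have n2 := supQ_nonneg Q (pdφ (pdφ u))
  have n0 := supQ_nonneg Q u
  rw [mul_comm, ← le_div_iff₀ hε]
  refine supQ_le (by positivity) fun p hp => ?_
  rw [le_div_iff₀ hε]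
  have := landau1 (g := fun x => u (x, p.2)) (g' := fun x => pdφ u (x, p.2))
    (g'' := fun x => pdφ (pdφ u) (x, p.2)) (c := φ0) (d := φ1) (h := ε * η)
    (fun x => by rw [pdφ_eq hu]; exact hu.hasφ (x, p.2))
    (fun x => by rw [pdφ_eq hu.pdφ]; exact hu.pdφ.hasφ (x, p.2))
    (by positivity) (by nlinarith)
    (fun x hx => le_supQ hQ hu (p := (x, p.2)) ⟨hx, hp.2⟩)
    (fun x hx => le_supQ hQ hu.pdφ.pdφ (p := (x, p.2)) ⟨hx, hp.2⟩) hp.1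
  simp only [Prod.mk.eta] at this
  rw [div_mul_eq_mul_div, le_div_iff₀ hη]
  have h3 : η ^ 2 ≤ 1 := by nlinarith
  have h4 : 0 ≤ ε ^ 2 * supQ Q (pdφ (pdφ u)) := by positivity
  nlinarith

lemma step_k {φ0 φ1 a b η ε : ℝ} (hη : 0 < η) (hη1 : η ≤ 1) (h1 : 2 * η ≤ b - a)
    (hε : 0 < ε) (hε1 : ε ≤ 1) {u : ℝ × ℝ → ℝ} (hu : Sm u) :
    ε * supQ (Icc φ0 φ1 ×ˢ Icc a b) (pdk u) ≤
      2 / η * (ε ^ 2 * supQ (Icc φ0 φ1 ×ˢ Icc a b) (pdk (pdk u)) +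
        supQ (Icc φ0 φ1 ×ˢ Icc a b) u) := by
  set Q := Icc φ0 φ1 ×ˢ Icc a b
  have hQ : IsCompact Q := isCompact_Icc.prod isCompact_Icc
  have n2 := supQ_nonneg Q (pdk (pdk u))
  have n0 := supQ_nonneg Q u
  rw [mul_comm, ← le_div_iff₀ hε]
  refine supQ_le (by positivity) fun p hp => ?_
  rw [le_div_iff₀ hε]
  have := landau1 (g := fun x => u (p.1, x)) (g' := fun x => pdk u (p.1, x))
    (g'' := fun x => pdk (pdk u) (p.1, x)) (c := a) (d := b) (h := ε * η)
    (fun x => by rw [pdk_eq hu]; exact hu.hask (p.1, x))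
    (fun x => by rw [pdk_eq hu.pdk]; exact hu.pdk.hask (p.1, x))
    (by positivity) (by nlinarith)
    (fun x hx => le_supQ hQ hu (p := (p.1, x)) ⟨hp.1, hx⟩)
    (fun x hx => le_supQ hQ hu.pdk.pdk (p := (p.1, x)) ⟨hp.1, hx⟩) hp.2
  simp only [Prod.mk.eta] at this
  rw [div_mul_eq_mul_div, le_div_iff₀ hη]
  have h3 : η ^ 2 ≤ 1 := by nlinarith
  have h4 : 0 ≤ ε ^ 2 * supQ Q (pdk (pdk u)) := by positivity
  nlinarith

lemma step_An {φ0 φ1 a b η ε : ℝ} (hη : 0 < η) (hη1 : η ≤ 1) (h1 : 2 * η ≤ φ1 - φ0)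
    (h2 : 2 * η ≤ b - a)
    (hε : 0 < ε) (hε1 : ε ≤ 1) {u : ℝ × ℝ → ℝ} (hu : Sm u) (j : ℕ) :
    ε * An (Icc φ0 φ1 ×ˢ Icc a b) u (j + 1) ≤
      ((j + 2) * (2 / η)) * (ε ^ 2 * An (Icc φ0 φ1 ×ˢ Icc a b) u (j + 2) +
        An (Icc φ0 φ1 ×ˢ Icc a b) u j) := by
  set Q := Icc φ0 φ1 ×ˢ Icc a b with hQdef
  have hterm : ∀ i ∈ Finset.range (j + 1 + 1), ε * supQ Q (pdφ^[i] (pdk^[j + 1 - i] u)) ≤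
      2 / η * (ε ^ 2 * An Q u (j + 2) + An Q u j) := by
    intro i hi
    rw [Finset.mem_range] at hi
    rcases i with _ | i
    · have s := step_k (φ0 := φ0) (φ1 := φ1) hη hη1 h2 hε hε1 (hu.itk j)
      have e1 := le_An Q u 0 (j + 2)
      have e2 := le_An Q u 0 j
      simp only [Function.iterate_zero, id, Nat.zero_add, Function.iterate_succ_apply',
        Nat.sub_zero] at e1 e2 ⊢
      refine s.trans ?_
      gcongr
    · obtain ⟨l, rfl⟩ : ∃ l, j = i + l := ⟨j - i, by omega⟩
      have s := step_φ (a := a) (b := b) hη hη1 h1 hε hε1 ((hu.itk l).itφ i)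
      have e1 := le_An Q u (i + 2) l
      have e2 := le_An Q u i l
      rw [show i + l + 1 - (i + 1) = l by omega]
      rw [show i + 2 + l = i + l + 2 by omega] at e1
      simp only [Function.iterate_succ_apply'] at e1 e2 ⊢
      refine s.trans ?_
      gcongr
  have := Finset.sum_le_sum hterm
  rw [← Finset.mul_sum, Finset.sum_const, Finset.card_range, nsmul_eq_mul] at this
  refine this.trans (le_of_eq ?_)
  push_cast
  ring

/-! ### abstract interpolation -/

lemma abstract_interp (K : ℕ → ℝ) (hK : ∀ j, 1 ≤ K j) (m : ℕ) :
    ∃ C : ℝ, 1 ≤ C ∧ ∀ A : ℕ → ℝ, (∀ j, 0 ≤ A j) →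
      (∀ ε : ℝ, 0 < ε → ε ≤ 1 → ∀ j, ε * A (j + 1) ≤ K j * (ε ^ 2 * A (j + 2) + A j)) →
      ∀ ε : ℝ, 0 < ε → ε ≤ 1 → ∀ j ≤ m, ε ^ j * A j ≤ C * (ε ^ m * A m + A 0) := by
  induction m with
  | zero =>
    refine ⟨1, le_rfl, fun A hA _ ε _ _ j hj => ?_⟩
    obtain rfl : j = 0 := by omega
    simp
    exact hA 0
  | succ m ih =>
    obtain ⟨C, hC, H⟩ := ih
    rcases m with _ | m
    · refine ⟨1, le_rfl, fun A hA _ ε hε _ j hj => ?_⟩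
      have := hA 0
      have : 0 ≤ ε * A 1 := mul_nonneg hε.le (hA 1)
      interval_cases j <;> simp <;> linarith
    · have hKm := hK m
      -- weights
      set k := K m
      obtain ⟨μ, hμ⟩ : ∃ μ, μ = 1 / (2 * k * C) := ⟨_, rfl⟩
      have hkC : 1 ≤ k * C := by nlinarith
      have hμ0 : 0 < μ := by rw [hμ]; positivity
      have hμ1 : μ ≤ 1 := by
        rw [hμ, div_le_one (by positivity)]; nlinarith
      have hμk : k * C * μ = 1 / 2 := by rw [hμ]; field_simp
      obtain ⟨D, hD⟩ : ∃ D, D = 2 * k + 2 * k * C * (μ ^ m)⁻¹ := ⟨_, rfl⟩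
      have hi : 0 < (μ ^ m)⁻¹ := by positivity
      have hD1 : 1 ≤ D := by
        have : 0 < 2 * k * C * (μ ^ m)⁻¹ := by positivity
        linarith
      refine ⟨C * (D + 1), by nlinarith, fun A hA hstep ε hε hε1 j hj => ?_⟩
      have top : ε ^ (m + 1) * A (m + 1) ≤ D * (ε ^ (m + 2) * A (m + 2) + A 0) := by
        have s := mul_le_mul_of_nonneg_left (hstep ε hε hε1 m) (pow_pos hε m).le
        have r := H A hA hstep (μ * ε) (by positivity) (by nlinarith) m (by omega)
        have r' : ε ^ m * A m ≤ C * (μ * (ε ^ (m + 1) * A (m + 1)) + (μ ^ m)⁻¹ * A 0) := by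
          have := mul_le_mul_of_nonneg_left r hi.le
          have hne : (μ ^ m) ≠ 0 := by positivity
          calc ε ^ m * A m = (μ ^ m)⁻¹ * ((μ * ε) ^ m * A m) := by
                rw [mul_pow]; field_simp
            _ ≤ _ := this
            _ = _ := by rw [mul_pow]; field_simp; ring
        have x1 : 0 ≤ ε ^ (m + 2) * A (m + 2) := mul_nonneg (by positivity) (hA _)
        have x0 := hA 0
        have s' : ε ^ (m + 1) * A (m + 1) ≤ k * (ε ^ (m + 2) * A (m + 2)) + k * (ε ^ m * A m) := by
          calc _ = ε ^ m * (ε * A (m + 1)) := by ring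
            _ ≤ _ := s
            _ = _ := by ring
        have r'' := mul_le_mul_of_nonneg_left r' (by linarith : 0 ≤ k)
        have e : k * (C * (μ * (ε ^ (m + 1) * A (m + 1)) + (μ ^ m)⁻¹ * A 0)) =
            1 / 2 * (ε ^ (m + 1) * A (m + 1)) + k * C * (μ ^ m)⁻¹ * A 0 := by
          rw [← hμk]; ring
        rw [e] at r''
        have y1 : 0 ≤ 2 * k * C * (μ ^ m)⁻¹ * (ε ^ (m + 2) * A (m + 2)) := by positivity
        have y2 : 0 ≤ 2 * k * A 0 := by positivity
        rw [hD]
        nlinarith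
      have x1 : 0 ≤ ε ^ (m + 2) * A (m + 2) := mul_nonneg (by positivity) (hA _)
      have x0 := hA 0
      have z : 0 ≤ ε ^ (m + 2) * A (m + 2) + A 0 := by linarith
      rcases Nat.lt_or_ge j (m + 2) with hj' | hj'
      · have r := H A hA hstep ε hε hε1 j (by omega)
        refine r.trans ?_
        rw [mul_assoc]
        refine mul_le_mul_of_nonneg_left ?_ (by linarith)
        linarith
      · obtain rfl : j = m + 2 := by omega
        have : 1 ≤ C * (D + 1) := by nlinarith
        calc _ ≤ ε ^ (m + 2) * A (m + 2) + A 0 := by linarith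
          _ ≤ _ := le_mul_of_one_le_left z this

lemma optimise {X K F G F0 G0 : ℝ} {m : ℕ} (hm : m ≠ 0) (hK : 0 ≤ K) (hF0 : 0 ≤ F0) (hG0 : 0 ≤ G0)
    (hF : F0 ≤ F) (hG : G0 ≤ G)
    (H : ∀ ε : ℝ, 0 < ε → ε ≤ 1 →
      ε ^ m * X ≤ K * ((ε ^ m * F + F0) * (ε ^ m * G + G0))) :
    X ≤ 4 * K * (F0 * G + F * G0) := by
  have H' : ∀ τ : ℝ, 0 < τ → τ ≤ 1 → τ * X ≤ K * ((τ * F + F0) * (τ * G + G0)) := by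
    intro τ h0 h1
    have e : (τ ^ ((m : ℝ)⁻¹)) ^ m = τ := Real.rpow_inv_natCast_pow h0.le hm
    have := H (τ ^ ((m : ℝ)⁻¹)) (Real.rpow_pos_of_pos h0 _)
      (Real.rpow_le_one h0.le h1 (by positivity))
    rwa [e] at this
  have hFn : 0 ≤ F := hF0.trans hF
  have hGn : 0 ≤ G := hG0.trans hG
  rcases (mul_nonneg hFn hGn).eq_or_lt with h | hFG
  · have := H' 1 one_pos le_rfl
    have h1 : F0 * G0 ≤ F * G0 := by gcongr
    have h2 : F0 * G0 ≤ F0 * G := by gcongr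
    nlinarith [mul_nonneg hF0 hGn, mul_nonneg hFn hG0, mul_nonneg hF0 hG0]
  · set x := F0 * G with hx
    set y := F * G0 with hy
    have hx0 : 0 ≤ x := mul_nonneg hF0 hGn
    have hy0 : 0 ≤ y := mul_nonneg hFn hG0
    have hxF : x ≤ F * G := by rw [hx]; gcongr
    have hyF : y ≤ F * G := by rw [hy]; gcongr
    have hxy : x * y = (F * G) * (F0 * G0) := by rw [hx, hy]; ring
    -- X ≤ K (τ FG + x + y + F0 G0 / τ)
    have H2 : ∀ t : ℝ, 0 < t → t ≤ 1 → x + y ≤ 2 * (t * (F * G)) →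
        X ≤ K * (t * (F * G) + 2 * (x + y)) := by
      intro t ht0 ht1 hts
      have h := H' t ht0 ht1
      have : F0 * G0 ≤ t * (x + y) := by
        have h3 : (F * G) * (F0 * G0) ≤ (F * G) * (t * (x + y)) := by
          rw [← hxy]
          nlinarith [sq_nonneg (x - y), mul_le_mul_of_nonneg_right hts (add_nonneg hx0 hy0)]
        exact le_of_mul_le_mul_left h3 hFG
      have h5 : (t * F + F0) * (t * G + G0) ≤ t * (t * (F * G) + 2 * (x + y)) := by
        rw [hx, hy] at *
        nlinarith
      have h6 := h.trans (mul_le_mul_of_nonneg_left h5 hK)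
      refine le_of_mul_le_mul_left (h6.trans (le_of_eq ?_)) ht0
      ring
    rcases (add_nonneg hx0 hy0).eq_or_lt with h0 | hpos
    · rw [← h0]
      simp only [mul_zero]
      refine le_of_forall_pos_le_add fun δ hδ => ?_
      have hKF : 0 ≤ K * (F * G) := mul_nonneg hK hFG.le
      have hq : 0 < δ + K * (F * G) := by linarith
      have := H2 (δ / (δ + K * (F * G))) (by positivity)
        (by rw [div_le_one hq]; linarith) (by rw [← h0]; positivity)
      rw [← h0] at this
      refine this.trans ?_
      have e : K * (δ / (δ + K * (F * G)) * (F * G) + 2 * 0) =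
        δ * (K * (F * G) / (δ + K * (F * G))) := by ring
      rw [e, zero_add]
      refine mul_le_of_le_one_right hδ.le ?_
      rw [div_le_one hq]; linarith
    · have ht : (x + y) / (2 * (F * G)) * (F * G) = (x + y) / 2 := by
        have hne := hFG.ne'
        rw [div_mul_eq_mul_div, mul_div_mul_right _ _ hne]
      have := H2 ((x + y) / (2 * (F * G))) (by positivity)
        (by rw [div_le_one (by positivity)]; linarith) (by rw [ht]; linarith)
      rw [ht] at this
      nlinarith [mul_nonneg hK hpos.le]

lemma interp_prod (φ0 φ1 a b : ℝ) (hφ : φ0 < φ1) (hab : a < b) (m : ℕ) (hm : m ≠ 0) :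
    ∃ C : ℝ, 1 ≤ C ∧ ∀ f g : ℝ × ℝ → ℝ, Sm f → Sm g → ∀ p q : ℕ, p + q = m →
      An (Icc φ0 φ1 ×ˢ Icc a b) f p * An (Icc φ0 φ1 ×ˢ Icc a b) g q ≤
      C * (gnorm (Icc φ0 φ1 ×ˢ Icc a b) 0 f * gnorm (Icc φ0 φ1 ×ˢ Icc a b) m g +
        gnorm (Icc φ0 φ1 ×ˢ Icc a b) m f * gnorm (Icc φ0 φ1 ×ˢ Icc a b) 0 g) := by
  obtain ⟨η, hη, hη1, h1, h2⟩ : ∃ η : ℝ, 0 < η ∧ η ≤ 1 ∧ 2 * η ≤ φ1 - φ0 ∧ 2 * η ≤ b - a := by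
    refine ⟨min 1 (min ((φ1 - φ0) / 2) ((b - a) / 2)), ?_, min_le_left _ _, ?_, ?_⟩
    · refine lt_min one_pos (lt_min ?_ ?_) <;> linarith
    · have := (min_le_right 1 (min ((φ1 - φ0) / 2) ((b - a) / 2))).trans (min_le_left _ _)
      linarith
    · have := (min_le_right 1 (min ((φ1 - φ0) / 2) ((b - a) / 2))).trans (min_le_right _ _)
      linarith
  obtain ⟨C, hC, H⟩ := abstract_interp (fun j => (j + 2) * (2 / η)) (fun j => by
    have : 2 ≤ 2 / η := by rw [le_div_iff₀ hη]; linarith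
    have hj : (0 : ℝ) ≤ j := j.cast_nonneg
    nlinarith) m
  set Q := Icc φ0 φ1 ×ˢ Icc a b with hQ
  refine ⟨4 * C ^ 2, by nlinarith, fun f g hf hg p q hpq => ?_⟩
  have key : ∀ u, Sm u → ∀ ε : ℝ, 0 < ε → ε ≤ 1 → ∀ j ≤ m,
      ε ^ j * An Q u j ≤ C * (ε ^ m * gnorm Q m u + gnorm Q 0 u) := by
    intro u hu ε hε hε1 j hj
    refine (H (An Q u) (An_nonneg Q u)
      (fun ε hε hε1 j => step_An hη hη1 h1 h2 hε hε1 hu j) ε hε hε1 j hj).trans ?_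
    rw [gnorm_zero]
    have := An_le_gnorm Q u (le_refl m)
    gcongr
  have nn : ∀ u, 0 ≤ gnorm Q 0 u := fun u => by rw [gnorm_zero]; exact An_nonneg _ _ _
  have mono : ∀ u, gnorm Q 0 u ≤ gnorm Q m u := fun u => by
    rw [gnorm_zero]; exact An_le_gnorm _ _ (Nat.zero_le _)
  refine optimise hm (by positivity) (nn f) (nn g) (mono f) (mono g) fun ε hε hε1 => ?_
  have a1 := key f hf ε hε hε1 p (by omega)
  have a2 := key g hg ε hε hε1 q (by omega)
  have n1 : 0 ≤ ε ^ q * An Q g q := mul_nonneg (by positivity) (An_nonneg _ _ _)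
  have n2 : 0 ≤ C * (ε ^ m * gnorm Q m f + gnorm Q 0 f) :=
    (mul_nonneg (by positivity) (An_nonneg _ _ _)).trans a1
  calc _ = (ε ^ p * An Q f p) * (ε ^ q * An Q g q) := by rw [← hpq, pow_add]; ring
    _ ≤ _ := mul_le_mul a1 a2 n1 n2
    _ = _ := by ring

/-- Tameness of the linearised RG operator `L(σ)v = ∂_k v - σ ∂_φ² v`:
`‖L(σ)v‖_n ≤ ‖v‖_{n+1} + C (‖σ‖₀ ‖v‖_{n+2} + ‖σ‖_{n+2} ‖v‖₀)`. -/
theorem linearised_RG_tame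
    (φ0 φ1 a b : ℝ) (n : ℕ) (hφ : φ0 < φ1) (hab : a < b) :
    ∃ C > (0 : ℝ), ∀ σ v : ℝ × ℝ → ℝ, ContDiff ℝ (⊤ : ℕ∞) σ → ContDiff ℝ (⊤ : ℕ∞) v →
      gnorm (Icc φ0 φ1 ×ˢ Icc a b) n (fun p => pdk v p - σ p * pdφ (pdφ v) p) ≤
        gnorm (Icc φ0 φ1 ×ˢ Icc a b) (n + 1) v +
          C * (gnorm (Icc φ0 φ1 ×ˢ Icc a b) 0 σ *
                 gnorm (Icc φ0 φ1 ×ˢ Icc a b) (n + 2) v +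
               gnorm (Icc φ0 φ1 ×ˢ Icc a b) (n + 2) σ *
                 gnorm (Icc φ0 φ1 ×ˢ Icc a b) 0 v) := by
  choose C hC1 hC using fun j : ℕ => interp_prod φ0 φ1 a b hφ hab (j + 2) (by omega)
  set Q := Icc φ0 φ1 ×ˢ Icc a b with hQdef
  have hQ : IsCompact Q := isCompact_Icc.prod isCompact_Icc
  have hCpos : ∀ j, 0 < C j := fun j => one_pos.trans_le (hC1 j)
  refine ⟨∑ j ∈ Finset.range (n + 1), (j + 1) * (2 ^ j * C j),
    Finset.sum_pos (fun j _ => by have := hCpos j; positivity) (by simp), fun σ v hσ hv => ?_⟩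
  replace hσ : Sm σ := hσ
  replace hv : Sm v := hv
  obtain ⟨R, hR⟩ : ∃ R, R = gnorm Q 0 σ * gnorm Q (n + 2) v + gnorm Q (n + 2) σ * gnorm Q 0 v :=
    ⟨_, rfl⟩
  rw [← hR]
  have gn : ∀ u j, 0 ≤ gnorm Q j u := fun u j => Finset.sum_nonneg fun j _ => An_nonneg Q u j
  have gmono : ∀ u {i j : ℕ}, i ≤ j → gnorm Q i u ≤ gnorm Q j u := fun u i j hij =>
    Finset.sum_le_sum_of_subset_of_nonneg (Finset.range_subset_range.2 (by omega))
      fun j _ _ => An_nonneg Q u j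
  have hR0 : 0 ≤ R := by
    rw [hR]
    exact add_nonneg (mul_nonneg (gn _ _) (gn _ _)) (mul_nonneg (gn _ _) (gn _ _))
  have hsm : Sm (σ * pdφ (pdφ v)) := ContDiff.mul hσ hv.pdφ.pdφ
  have hterm : ∀ j ≤ n, ∀ i ≤ j,
      supQ Q (pdφ^[i] (pdk^[j - i] (pdk v - σ * pdφ (pdφ v)))) ≤
        supQ Q (pdφ^[i] (pdk^[j + 1 - i] v)) + 2 ^ j * C j * R := by
    intro j hj i hi
    obtain ⟨l, rfl⟩ : ∃ l, j = i + l := ⟨j - i, by omega⟩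
    rw [show i + l - i = l by omega, show i + l + 1 - i = l + 1 by omega,
      pdk_it_sub hv.pdk hsm, pdφ_it_sub (hv.pdk.itk l) (hsm.itk l), Function.iterate_succ_apply]
    have hc := hCpos (i + l)
    refine supQ_le (add_nonneg (supQ_nonneg _ _) (by positivity)) fun p hp => ?_
    rw [Pi.sub_apply]
    refine (abs_sub _ _).trans (add_le_add (le_supQ hQ ((hv.pdk.itk l).itφ i) hp) ?_)
    have hL : LB σ v 2 1 (σ * pdφ (pdφ v)) := LB.prod 0 0 2 0
    have hL' := (hL.itk hσ hv l).itφ hσ hv i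
    have := hL'.bound p (C (i + l) * R) (by
      intro i1 l1 i2 l2 hs
      have b1 := (le_supQ hQ ((hσ.itk l1).itφ i1) hp).trans (le_An Q σ i1 l1)
      have b2 := (le_supQ hQ ((hv.itk l2).itφ i2) hp).trans (le_An Q v i2 l2)
      refine (mul_le_mul b1 b2 (abs_nonneg _) (An_nonneg _ _ _)).trans ?_
      refine (hC (i + l) σ v hσ hv (i1 + l1) (i2 + l2) (by omega)).trans ?_
      refine mul_le_mul_of_nonneg_left ?_ hc.le
      rw [hR]
      exact add_le_add (mul_le_mul_of_nonneg_left (gmono v (by omega)) (gn _ _))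
        (mul_le_mul_of_nonneg_right (gmono σ (by omega)) (gn _ _)))
    refine this.trans (le_of_eq ?_)
    push_cast
    rw [pow_add]
    ring
  have hlev : ∀ j ∈ Finset.range (n + 1), An Q (pdk v - σ * pdφ (pdφ v)) j ≤
      An Q v (j + 1) + (j + 1) * (2 ^ j * C j) * R := by
    intro j hj
    rw [Finset.mem_range] at hj
    have h1 := Finset.sum_le_sum fun i (hi : i ∈ Finset.range (j + 1)) =>
      hterm j (by omega) i (by rw [Finset.mem_range] at hi; omega)
    refine h1.trans ?_
    rw [Finset.sum_add_distrib, Finset.sum_const, Finset.card_range, nsmul_eq_mul]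
    refine add_le_add ?_ (le_of_eq (by push_cast; ring))
    rw [An, Finset.sum_range_succ _ (j + 1)]
    exact le_add_of_nonneg_right (supQ_nonneg _ _)
  change gnorm Q n (pdk v - σ * pdφ (pdφ v)) ≤ _
  rw [gnorm_eq]
  refine (Finset.sum_le_sum hlev).trans ?_
  rw [Finset.sum_add_distrib, Finset.sum_mul]
  refine add_le_add ?_ le_rfl
  rw [gnorm_eq, Finset.sum_range_succ' _ (n + 1)]
  exact le_add_of_nonneg_right (An_nonneg _ _ _)
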